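/- arXiv:1410.2729 — 2 statements merged into one kernel-verified Lean document; each statement's English description precedes it below -/
import Mathlib

section
/- Let {S_{a^[k]}, k≥0} be a local, bounded non-stationary subdivision scheme which reproduces constants and satisfies Condition A, with constants K ≥ 0, n > 0 and μ < 1 as in Condition A, and set μ̂ := μ^{1/n}. Then the scheme converges; moreover there exists a positive constant C such that for every bounded initial sequence f^[0] and every k ≥ 0, ‖S^∞ f^[0] − PL(f^[k])‖_∞ ≤ C μ̂^k ‖Δ f^[0]‖_∞, where f^[k] are the sequences generated by the scheme from f^[0]. -/
open Filter Set

/-- The subdivision operator associated to a mask `a`: `(S_a f)_i = ∑_j a_{i-2j} f_j`. -/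
noncomputable def subOp (a : ℤ → ℝ) (f : ℤ → ℝ) : ℤ → ℝ :=
  fun i => ∑ᶠ j : ℤ, a (i - 2 * j) * f j

/-- The difference mask `q` of a mask `a`: `q_i = ∑_{j ≤ i} (-1)^(i-j) a_j`. -/
noncomputable def diffMask (a : ℤ → ℝ) : ℤ → ℝ :=
  fun i => ∑ᶠ j ∈ {j : ℤ | j ≤ i}, (-1 : ℝ) ^ (i - j) * a j

/-- A sequence is bounded. -/
def IsBoundedSeq (f : ℤ → ℝ) : Prop := ∃ M : ℝ, ∀ i, |f i| ≤ M

/-- Sup-norm of a sequence. -/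
noncomputable def seqNorm (f : ℤ → ℝ) : ℝ := ⨆ i : ℤ, |f i|

/-- Operator sup-norm of an operator on sequences, taken over bounded sequences of
sup-norm at most one. -/
noncomputable def opNorm (T : (ℤ → ℝ) → ℤ → ℝ) : ℝ :=
  sSup { c : ℝ | ∃ f : ℤ → ℝ, IsBoundedSeq f ∧ seqNorm f ≤ 1 ∧ c = seqNorm (T f) }

/-- The hat function `H(x) = max (1 - |x|) 0`. -/
noncomputable def hatF (x : ℝ) : ℝ := max (1 - |x|) 0

/-- The piecewise linear interpolant at level `k` of the data `f` on the grid `2^{-k} ℤ`. -/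
noncomputable def PL (k : ℕ) (f : ℤ → ℝ) : ℝ → ℝ :=
  fun x => ∑ᶠ i : ℤ, f i * hatF (2 ^ k * x - (i : ℝ))

/-- Backward difference operator on sequences. -/
def bdiff (f : ℤ → ℝ) : ℤ → ℝ := fun i => f i - f (i - 1)

/-- `compOps q k n = S_{q^[k+n-1]} ∘ ⋯ ∘ S_{q^[k+1]} ∘ S_{q^[k]}`. -/
noncomputable def compOps (q : ℕ → ℤ → ℝ) (k : ℕ) : ℕ → (ℤ → ℝ) → ℤ → ℝ
  | 0 => id
  | n + 1 => subOp (q (k + n)) ∘ compOps q k n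

/-- A mask reproduces constants: `∑_i a_{2i} = ∑_i a_{2i+1} = 1`. -/
def ReproducesConstants (a : ℤ → ℝ) : Prop :=
  (∑ᶠ i : ℤ, a (2 * i)) = 1 ∧ (∑ᶠ i : ℤ, a (2 * i + 1)) = 1

/-- Two sequences of masks are asymptotically similar. -/
def AsympSimilar (a b : ℕ → ℤ → ℝ) : Prop :=
  Tendsto (fun k => seqNorm (fun i => a k i - b k i)) atTop (nhds 0)

/-- Condition A for a non-stationary scheme with masks `a`. -/
def ConditionA (a : ℕ → ℤ → ℝ) : Prop :=
  ∃ K n : ℕ, 0 < n ∧ ∃ μ : ℝ, μ < 1 ∧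
    ∀ k, K ≤ k → opNorm (compOps (fun j => diffMask (a j)) k n) ≤ μ

theorem subOp_eq (a f : ℤ → ℝ) (N : ℕ) (hN : 0 < N)
    (h : ∀ i : ℤ, (N : ℤ) < |i| → a i = 0) (i : ℤ) :
    subOp a f i = ∑ j ∈ Finset.Icc (i / 2 - N) (i / 2 + N), a (i - 2 * j) * f j := by
  unfold subOp
  apply finsum_eq_sum_of_support_subset
  intro j hj
  rw [Function.mem_support] at hj
  have : ¬ (N : ℤ) < |i - 2 * j| := fun h' => hj (by rw [h _ h', zero_mul])
  rw [not_lt, abs_le] at this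
  simp only [Finset.coe_Icc, Set.mem_Icc]
  omega

theorem finsum_mask (a : ℤ → ℝ) (hrc : ReproducesConstants a) (i : ℤ) :
    ∑ᶠ j : ℤ, a (i - 2 * j) = 1 := by
  obtain ⟨h0, h1⟩ := hrc
  rcases Int.even_or_odd' i with ⟨m, rfl | rfl⟩
  · rw [← h0, ← finsum_comp_equiv (Equiv.subLeft m)]
    apply finsum_congr
    intro j
    simp only [Equiv.subLeft_apply]
    congr 1; ring
  · rw [← h1, ← finsum_comp_equiv (Equiv.subLeft m)]
    apply finsum_congr
    intro j
    simp only [Equiv.subLeft_apply]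
    congr 1; ring

theorem sum_mask (a : ℤ → ℝ) (N : ℕ) (hN : 0 < N)
    (h : ∀ i : ℤ, (N : ℤ) < |i| → a i = 0) (hrc : ReproducesConstants a) (i : ℤ) :
    ∑ j ∈ Finset.Icc (i / 2 - N) (i / 2 + N), a (i - 2 * j) = 1 := by
  have h1 := subOp_eq a (fun _ => 1) N hN h i
  simp only [subOp, mul_one] at h1
  rw [← h1, finsum_mask a hrc i]

theorem card_aux (m : ℤ) (N : ℕ) : (Finset.Icc (m - N) (m + N)).card = 2 * N + 1 := by
  rw [Int.card_Icc]; omega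

theorem subOp_bound (a f : ℤ → ℝ) (N : ℕ) (hN : 0 < N)
    (h : ∀ i : ℤ, (N : ℤ) < |i| → a i = 0) (M F : ℝ) (hM : ∀ i, |a i| ≤ M)
    (hF : ∀ i, |f i| ≤ F) (i : ℤ) :
    |subOp a f i| ≤ (2 * N + 1) * (M * F) := by
  rw [subOp_eq a f N hN h]
  refine (Finset.abs_sum_le_sum_abs _ _).trans ?_
  refine (Finset.sum_le_card_nsmul _ _ (M * F) ?_).trans ?_
  · intro j _
    rw [abs_mul]
    exact mul_le_mul (hM _) (hF _) (abs_nonneg _) ((abs_nonneg _).trans (hM 0))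
  · rw [card_aux, nsmul_eq_mul]; push_cast; exact le_rfl

theorem diff_nat (f : ℤ → ℝ) (D : ℝ) (hD : ∀ i, |bdiff f i| ≤ D) (p : ℕ) (m : ℤ) :
    |f (m + p) - f m| ≤ p * D := by
  induction p with
  | zero => simp
  | succ p ih =>
    have h1 := hD (m + (p + 1 : ℕ))
    unfold bdiff at h1
    have e : m + ((p + 1 : ℕ) : ℤ) - 1 = m + p := by push_cast; ring
    rw [e] at h1
    have := abs_sub_le (f (m + (p + 1 : ℕ))) (f (m + p)) (f m)
    push_cast at *
    linarith

theorem diff_int (f : ℤ → ℝ) (D : ℝ) (hD : ∀ i, |bdiff f i| ≤ D) (N : ℕ) (m j : ℤ)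
    (h1 : m - N ≤ j) (h2 : j ≤ m + N) :
    |f j - f m| ≤ N * D := by
  have hD0 : 0 ≤ D := (abs_nonneg _).trans (hD 0)
  rcases le_total m j with h | h
  · obtain ⟨p, rfl⟩ := Int.le.dest h
    have hp : p ≤ N := by omega
    have := diff_nat f D hD p m
    have h3 : (p : ℝ) * D ≤ N * D := by gcongr
    linarith
  · obtain ⟨p, rfl⟩ := Int.le.dest h
    have hp : p ≤ N := by omega
    have := diff_nat f D hD p j
    rw [abs_sub_comm] at this
    have h3 : (p : ℝ) * D ≤ N * D := by gcongr
    linarith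

theorem subOp_near (a f : ℤ → ℝ) (N : ℕ) (hN : 0 < N)
    (h : ∀ i : ℤ, (N : ℤ) < |i| → a i = 0) (hrc : ReproducesConstants a) (M D : ℝ)
    (hM : ∀ i, |a i| ≤ M) (hD : ∀ i, |bdiff f i| ≤ D) (i : ℤ) :
    |subOp a f i - f (i / 2)| ≤ (2 * N + 1) * (M * N) * D := by
  have e : subOp a f i - f (i / 2) =
      ∑ j ∈ Finset.Icc (i / 2 - N) (i / 2 + N), a (i - 2 * j) * (f j - f (i / 2)) := by
    rw [subOp_eq a f N hN h]
    simp only [mul_sub, Finset.sum_sub_distrib, ← Finset.sum_mul]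
    rw [sum_mask a N hN h hrc, one_mul]
  rw [e]
  refine (Finset.abs_sum_le_sum_abs _ _).trans ?_
  refine (Finset.sum_le_card_nsmul _ _ (M * (N * D)) ?_).trans ?_
  · intro j hj
    rw [Finset.mem_Icc] at hj
    rw [abs_mul]
    exact mul_le_mul (hM _) (diff_int f D hD N _ _ hj.1 hj.2) (abs_nonneg _)
      ((abs_nonneg _).trans (hM 0))
  · rw [card_aux, nsmul_eq_mul]; push_cast; apply le_of_eq; ring

theorem bdiff_subOp_bound (a f : ℤ → ℝ) (N : ℕ) (hN : 0 < N)
    (h : ∀ i : ℤ, (N : ℤ) < |i| → a i = 0) (hrc : ReproducesConstants a) (M D : ℝ)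
    (hM : ∀ i, |a i| ≤ M) (hD : ∀ i, |bdiff f i| ≤ D) (i : ℤ) :
    |bdiff (subOp a f) i| ≤ (2 * ((2 * N + 1) * (M * N)) + 1) * D := by
  have h1 := subOp_near a f N hN h hrc M D hM hD i
  have h2 := subOp_near a f N hN h hrc M D hM hD (i - 1)
  have hD0 : 0 ≤ D := (abs_nonneg _).trans (hD 0)
  have h3 : |f (i / 2) - f ((i - 1) / 2)| ≤ D := by
    have := diff_int f D hD 1 ((i - 1) / 2) (i / 2) (by push_cast; omega) (by push_cast; omega)
    simpa using this
  unfold bdiff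
  rw [abs_le] at *
  constructor <;> linarith [h1.1, h1.2, h2.1, h2.2, h3.1, h3.2]

theorem PL_near (k : ℕ) (f : ℤ → ℝ) (D : ℝ) (hD : ∀ i, |bdiff f i| ≤ D) (x : ℝ) :
    |PL k f x - f ⌊2 ^ k * x⌋| ≤ D := by
  set y := (2 : ℝ) ^ k * x with hy
  set m := ⌊y⌋ with hm
  have hm1 : (m : ℝ) ≤ y := Int.floor_le y
  have hm2 : y < m + 1 := Int.lt_floor_add_one y
  have e : PL k f x = ∑ i ∈ ({m, m + 1} : Finset ℤ), f i * hatF (y - i) := by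
    unfold PL
    rw [← hy]
    apply finsum_eq_sum_of_support_subset
    intro i hi
    rw [Function.mem_support] at hi
    by_contra hc
    apply hi
    have : hatF (y - i) = 0 := by
      unfold hatF
      apply max_eq_right
      have hc' : i ≤ m - 1 ∨ m + 2 ≤ i := by
        simp at hc
        omega
      rcases hc' with hc' | hc'
      · have : (i : ℝ) ≤ m - 1 := by exact_mod_cast hc'
        have := le_abs_self (y - i)
        linarith
      · have : (m : ℝ) + 2 ≤ i := by exact_mod_cast hc'
        have := neg_le_abs (y - i)
        linarith
    rw [this, mul_zero]
  have h1 : hatF (y - m) = 1 - (y - m) := by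
    unfold hatF
    rw [abs_of_nonneg (by linarith), max_eq_left (by linarith)]
  have h2 : hatF (y - (m + 1 : ℤ)) = y - m := by
    unfold hatF
    push_cast
    rw [abs_of_nonpos (by linarith), max_eq_left (by linarith)]
    ring
  rw [e, Finset.sum_pair (by omega), h1, h2]
  have h3 := hD (m + 1)
  unfold bdiff at h3
  rw [add_sub_cancel_right] at h3
  have e2 : f m * (1 - (y - m)) + f (m + 1) * (y - m) - f m = (f (m + 1) - f m) * (y - m) := by
    ring
  rw [e2, abs_mul, abs_of_nonneg (by linarith : 0 ≤ y - m)]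
  nlinarith [abs_nonneg (f (m + 1) - f m)]

theorem PL_step (k : ℕ) (a f : ℤ → ℝ) (N : ℕ) (hN : 0 < N)
    (h : ∀ i : ℤ, (N : ℤ) < |i| → a i = 0) (hrc : ReproducesConstants a) (M D : ℝ)
    (hM : ∀ i, |a i| ≤ M) (hD : ∀ i, |bdiff f i| ≤ D) (x : ℝ) :
    |PL k f x - PL (k + 1) (subOp a f) x| ≤ (3 * ((2 * N + 1) * (M * N)) + 2) * D := by
  have h1 := PL_near k f D hD x
  have h2 := PL_near (k + 1) (subOp a f) _ (bdiff_subOp_bound a f N hN h hrc M D hM hD) x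
  have h3 := subOp_near a f N hN h hrc M D hM hD ⌊2 ^ (k + 1) * x⌋
  have e : ⌊(2 : ℝ) ^ (k + 1) * x⌋ / 2 = ⌊(2 : ℝ) ^ k * x⌋ := by
    have e1 : (2 : ℝ) ^ k * x = (2 ^ (k + 1) * x) / (2 : ℕ) := by push_cast; ring
    rw [e1, Int.floor_div_natCast]
    rfl
  rw [e] at h3
  rw [abs_le] at *
  constructor <;> linarith [h1.1, h1.2, h2.1, h2.2, h3.1, h3.2]

theorem diffMask_eq (a : ℤ → ℝ) (N : ℕ)
    (h : ∀ i : ℤ, (N : ℤ) < |i| → a i = 0) (i : ℤ) :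
    diffMask a i = ∑ j ∈ Finset.Icc (-(N : ℤ)) N,
      if j ≤ i then (-1 : ℝ) ^ (i - j) * a j else 0 := by
  unfold diffMask
  rw [finsum_mem_def]
  rw [finsum_eq_sum_of_support_subset (s := Finset.Icc (-(N : ℤ)) N)]
  · apply Finset.sum_congr rfl
    intro j _
    simp [Set.indicator_apply]
  · intro j hj
    rw [Function.mem_support] at hj
    have : ¬ (N : ℤ) < |j| := fun h' => hj (by simp [Set.indicator_apply, h _ h'])
    rw [not_lt, abs_le] at this
    simpa using this

theorem diffMask_add (a : ℤ → ℝ) (N : ℕ)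
    (h : ∀ i : ℤ, (N : ℤ) < |i| → a i = 0) (i : ℤ) :
    diffMask a i + diffMask a (i - 1) = a i := by
  rw [diffMask_eq a N h, diffMask_eq a N h, ← Finset.sum_add_distrib]
  have : ∀ j ∈ Finset.Icc (-(N : ℤ)) N, ((if j ≤ i then (-1 : ℝ) ^ (i - j) * a j else 0) +
      (if j ≤ i - 1 then (-1 : ℝ) ^ (i - 1 - j) * a j else 0)) = if j = i then a j else 0 := by
    intro j _
    rcases lt_trichotomy j i with hj | hj | hj
    · rw [if_pos hj.le, if_pos (by omega), if_neg hj.ne]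
      have : i - j = (i - 1 - j) + 1 := by ring
      rw [this, zpow_add_one₀ (by norm_num)]
      ring
    · subst hj
      simp
    · rw [if_neg (by omega), if_neg (by omega), if_neg (by omega)]
      simp
  rw [Finset.sum_congr rfl this, Finset.sum_ite_eq']
  split_ifs with hi
  · rfl
  · symm
    apply h
    by_contra hc
    rw [not_lt, abs_le] at hc
    exact hi (by simpa using hc)

theorem tele (b : ℤ → ℝ) (s : ℤ) (p : ℕ) :
    ∑ m ∈ Finset.Icc s (s + p), (b m - b (m - 1)) = b (s + p) - b (s - 1) := by
  induction p with
  | zero => simp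
  | succ p ih =>
    have : Finset.Icc s (s + (p + 1 : ℕ)) = insert (s + (p + 1 : ℕ)) (Finset.Icc s (s + p)) := by
      ext j
      simp only [Finset.mem_Icc, Finset.mem_insert]
      omega
    rw [this, Finset.sum_insert (by simp), ih]
    have e : s + ((p + 1 : ℕ) : ℤ) - 1 = s + p := by push_cast; ring
    rw [e]
    ring

theorem diffMask_supp (a : ℤ → ℝ) (N : ℕ) (hN : 0 < N)
    (h : ∀ i : ℤ, (N : ℤ) < |i| → a i = 0) (hrc : ReproducesConstants a) (i : ℤ)
    (hi : ((2 * N + 1 : ℕ) : ℤ) < |i|) : diffMask a i = 0 := by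
  have hneg : ∀ i : ℤ, i < -N → diffMask a i = 0 := by
    intro i hi
    rw [diffMask_eq a N h]
    apply Finset.sum_eq_zero
    intro j hj
    rw [Finset.mem_Icc] at hj
    rw [if_neg (by omega)]
  have hcen : diffMask a (2 * N + 1) = 0 := by
    have h0 := sum_mask a N hN h hrc 0
    have h1 := sum_mask a N hN h hrc 1
    have e0 : ((0 : ℤ) / 2) = 0 := by norm_num
    have e1 : ((1 : ℤ) / 2) = 0 := by norm_num
    rw [e0] at h0
    rw [e1] at h1
    have ht := tele (fun m => diffMask a (1 - 2 * (-m))) (0 - N) (2 * N)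
    have e2 : (0 - (N : ℤ) + (2 * N : ℕ)) = 0 + N := by push_cast; ring
    rw [e2] at ht
    have e3 : ∑ m ∈ Finset.Icc (0 - (N : ℤ)) (0 + N),
        (diffMask a (1 - 2 * (-m)) - diffMask a (1 - 2 * (-(m - 1)))) =
        ∑ m ∈ Finset.Icc (0 - (N : ℤ)) (0 + N), a (1 - 2 * (-m)) -
        ∑ m ∈ Finset.Icc (0 - (N : ℤ)) (0 + N), a (0 - 2 * (-m)) := by
      rw [← Finset.sum_sub_distrib]
      apply Finset.sum_congr rfl
      intro m _
      rw [← diffMask_add a N h (1 - 2 * (-m)), ← diffMask_add a N h (0 - 2 * (-m))]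
      have x1 : 1 - 2 * (-m) - 1 = 0 - 2 * (-m) := by ring
      have x2 : 0 - 2 * (-m) - 1 = 1 - 2 * (-(m - 1)) := by ring
      rw [x1, x2]
      ring
    have hneg_sum : ∀ g : ℤ → ℝ, ∑ m ∈ Finset.Icc (0 - (N : ℤ)) (0 + N), g (-m) =
        ∑ m ∈ Finset.Icc (0 - (N : ℤ)) (0 + N), g m := by
      intro g
      apply Finset.sum_nbij' (fun m => -m) (fun m => -m)
      all_goals intro m
      all_goals simp
      all_goals omega
    have e4 := hneg_sum (fun m => a (1 - 2 * m))
    have e5 := hneg_sum (fun m => a (0 - 2 * m))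
    beta_reduce at e4 e5 ht
    rw [e3, e4, e5, h0, h1, hneg (1 - 2 * -(0 - (N : ℤ) - 1)) (by omega)] at ht
    have e6 : (1 - 2 * -(0 + (N : ℤ))) = 2 * N + 1 := by ring
    rw [e6] at ht
    linarith
  have hpos : ∀ p : ℕ, diffMask a (2 * N + 1 + p) = 0 := by
    intro p
    induction p with
    | zero => simpa using hcen
    | succ p ih =>
      have := diffMask_add a N h (2 * N + 1 + (p + 1 : ℕ))
      have e : 2 * (N : ℤ) + 1 + ((p + 1 : ℕ) : ℤ) - 1 = 2 * N + 1 + p := by push_cast; ring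
      rw [e, ih, add_zero] at this
      rw [this]
      apply h
      rw [abs_of_nonneg (by omega)]
      omega
  rcases lt_abs.1 hi with hi | hi
  · obtain ⟨p, hp⟩ := Int.le.dest hi.le
    rw [← hp]
    have := hpos p
    push_cast
    exact this
  · apply hneg
    push_cast at hi
    omega

theorem mask_bdd (q : ℤ → ℝ) (N : ℕ) (h : ∀ i : ℤ, (N : ℤ) < |i| → q i = 0) :
    ∃ M : ℝ, ∀ i, |q i| ≤ M := by
  refine ⟨∑ j ∈ Finset.Icc (-(N : ℤ)) N, |q j|, fun i => ?_⟩
  by_cases hi : (N : ℤ) < |i|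
  · rw [h i hi, abs_zero]
    exact Finset.sum_nonneg fun _ _ => abs_nonneg _
  · rw [not_lt, abs_le] at hi
    exact Finset.single_le_sum (f := fun j => |q j|) (fun _ _ => abs_nonneg _)
      (Finset.mem_Icc.2 hi)

theorem fin_supp (q f : ℤ → ℝ) (N : ℕ)
    (h : ∀ i : ℤ, (N : ℤ) < |i| → q i = 0) (i : ℤ) :
    (Function.support fun j => q (i - 2 * j) * f j).Finite := by
  apply (Set.finite_Icc (i / 2 - N - 1) (i / 2 + N + 1)).subset
  intro j hj
  rw [Function.mem_support] at hj
  have : ¬ (N : ℤ) < |i - 2 * j| := fun h' => hj (by rw [h _ h', zero_mul])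
  rw [not_lt, abs_le] at this
  simp only [Set.mem_Icc]
  omega

theorem commute (a q f : ℤ → ℝ) (N : ℕ)
    (hq : ∀ i : ℤ, (N : ℤ) < |i| → q i = 0) (haq : ∀ i, q i + q (i - 1) = a i) :
    subOp q (bdiff f) = bdiff (subOp a f) := by
  funext i
  have ha : ∀ i : ℤ, ((N + 1 : ℕ) : ℤ) < |i| → a i = 0 := by
    intro i hi
    have hi' := lt_abs.1 hi
    push_cast at hi'
    rw [← haq, hq i (lt_abs.2 (by omega)), hq (i - 1) (lt_abs.2 (by omega)), add_zero]
  unfold bdiff subOp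
  rw [← finsum_sub_distrib (fin_supp a f _ ha i) (fin_supp a f _ ha (i - 1))]
  have e1 : ∀ j, q (i - 2 * j) * (f j - f (j - 1)) =
      q (i - 2 * j) * f j - q (i - 2 * j) * f (j - 1) := fun j => by ring
  rw [finsum_congr e1, finsum_sub_distrib (fin_supp q f _ hq i)
    (fin_supp q (fun j => f (j - 1)) _ hq i)]
  have e2 : ∑ᶠ j, q (i - 2 * j) * f (j - 1) = ∑ᶠ j, q (i - 2 - 2 * j) * f j := by
    rw [← finsum_comp_equiv (Equiv.subRight (1 : ℤ)) (f := fun j => q (i - 2 - 2 * j) * f j)]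
    apply finsum_congr
    intro j
    simp only [Equiv.subRight_apply]
    congr 2; ring
  rw [e2, ← finsum_sub_distrib (fin_supp q f _ hq i) (fin_supp q f _ hq (i - 2))]
  apply finsum_congr
  intro j
  rw [← haq, ← haq]
  have x1 : i - 1 - 2 * j = i - 2 * j - 1 := by ring
  have x2 : i - 2 - 2 * j = i - 2 * j - 1 - 1 := by ring
  rw [x1, x2]
  ring

theorem compOps_commute (a : ℕ → ℤ → ℝ) (N : ℕ) (hN : 0 < N)
    (h : ∀ k, ∀ i : ℤ, (N : ℤ) < |i| → a k i = 0) (hrc : ∀ k, ReproducesConstants (a k))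
    (k n : ℕ) (f : ℤ → ℝ) :
    compOps (fun j => diffMask (a j)) k n (bdiff f) = bdiff (compOps a k n f) := by
  induction n with
  | zero => rfl
  | succ n ih =>
    simp only [compOps, Function.comp]
    rw [ih]
    exact commute _ _ _ (2 * N + 1) (diffMask_supp _ N hN (h _) (hrc _))
      (diffMask_add _ N (h _))

theorem compOps_smul (q : ℕ → ℤ → ℝ) (k n : ℕ) (c : ℝ) (f : ℤ → ℝ) :
    compOps q k n (fun i => c * f i) = fun i => c * compOps q k n f i := by
  induction n with
  | zero => rfl
  | succ n ih =>
    simp only [compOps, Function.comp]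
    rw [ih]
    funext i
    unfold subOp
    rw [← smul_eq_mul, smul_finsum]
    apply finsum_congr
    intro j
    rw [smul_eq_mul]
    ring

theorem compOps_bdd (q : ℕ → ℤ → ℝ) (N : ℕ) (hN : 0 < N)
    (h : ∀ k, ∀ i : ℤ, (N : ℤ) < |i| → q k i = 0) (k n : ℕ) :
    ∃ B : ℝ, ∀ f : ℤ → ℝ, (∀ i, |f i| ≤ 1) → ∀ i, |compOps q k n f i| ≤ B := by
  induction n with
  | zero => exact ⟨1, fun f hf => hf⟩
  | succ n ih =>
    obtain ⟨B, hB⟩ := ih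
    obtain ⟨M, hM⟩ := mask_bdd (q (k + n)) N (h _)
    exact ⟨_, fun f hf i => subOp_bound _ _ N hN (h _) M B hM (hB f hf) i⟩

theorem le_seqNorm (f : ℤ → ℝ) (hf : IsBoundedSeq f) (i : ℤ) : |f i| ≤ seqNorm f := by
  obtain ⟨M, hM⟩ := hf
  exact le_ciSup (f := fun i => |f i|) ⟨M, by rintro _ ⟨j, rfl⟩; exact hM j⟩ i

theorem opNorm_bound (q : ℕ → ℤ → ℝ) (N : ℕ) (hN : 0 < N)
    (h : ∀ k, ∀ i : ℤ, (N : ℤ) < |i| → q k i = 0) (k n : ℕ) (μ : ℝ)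
    (hμ : opNorm (compOps q k n) ≤ μ) (f : ℤ → ℝ) (D : ℝ) (hD : ∀ i, |f i| ≤ D) (i : ℤ) :
    |compOps q k n f i| ≤ μ * D := by
  obtain ⟨B, hB⟩ := compOps_bdd q N hN h k n
  have hunit : ∀ f : ℤ → ℝ, (∀ i, |f i| ≤ 1) → ∀ i, |compOps q k n f i| ≤ μ := by
    intro f hf i
    refine (le_seqNorm _ ⟨B, hB f hf⟩ i).trans (le_trans ?_ hμ)
    apply le_csSup
    · refine ⟨B, ?_⟩
      rintro c ⟨g, hg, hg1, rfl⟩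
      exact ciSup_le fun i => hB g (fun j => (le_seqNorm g hg j).trans hg1) i
    · exact ⟨f, ⟨1, hf⟩, ciSup_le hf, rfl⟩
  have hD0 : 0 ≤ D := (abs_nonneg _).trans (hD 0)
  rcases hD0.eq_or_lt with h0 | h0
  · have hz : f = fun i => 0 * f i := by
      funext j
      have := hD j
      rw [← h0] at this
      rw [zero_mul]
      exact abs_nonpos_iff.1 this
    rw [hz, compOps_smul, ← h0]
    simp
  · have hz : f = fun i => D * (fun j => D⁻¹ * f j) i := by
      funext j
      field_simp
    rw [hz, compOps_smul, abs_mul, abs_of_pos h0, mul_comm]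
    refine mul_le_mul_of_nonneg_right (hunit _ ?_ i) hD0
    intro j
    rw [abs_mul, abs_of_pos (inv_pos.2 h0), inv_mul_le_iff₀ h0]
    simpa using hD j

theorem compOps_fs (a : ℕ → ℤ → ℝ) (fs : ℕ → ℤ → ℝ)
    (h : ∀ k, fs (k + 1) = subOp (a k) (fs k)) (k n : ℕ) :
    compOps a k n (fs k) = fs (k + n) := by
  induction n with
  | zero => rfl
  | succ n ih =>
    simp only [compOps, Function.comp]
    rw [ih, ← add_assoc, h]

theorem step_pres (a : ℕ → ℤ → ℝ) (N : ℕ) (hN : 0 < N)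
    (h : ∀ k, ∀ i : ℤ, (N : ℤ) < |i| → a k i = 0) (hrc : ∀ k, ReproducesConstants (a k))
    (k n : ℕ) (f : ℤ → ℝ) (hf : ∃ R : ℕ, ∀ i : ℤ, (i < -R → f i = 0) ∧ (R < i → f i = 1)) :
    ∃ R : ℕ, ∀ i : ℤ, (i < -R → compOps a k n f i = 0) ∧ (R < i → compOps a k n f i = 1) := by
  induction n with
  | zero => exact hf
  | succ n ih =>
    obtain ⟨R, hR⟩ := ih
    refine ⟨2 * R + 2 * N + 2, fun i => ⟨fun hi => ?_, fun hi => ?_⟩⟩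
    · simp only [compOps, Function.comp]
      rw [subOp_eq _ _ N hN (h _)]
      apply Finset.sum_eq_zero
      intro j hj
      rw [Finset.mem_Icc] at hj
      push_cast at hi
      rw [(hR j).1 (by omega), mul_zero]
    · simp only [compOps, Function.comp]
      rw [subOp_eq _ _ N hN (h _), ← sum_mask (a (k + n)) N hN (h _) (hrc _) i]
      apply Finset.sum_congr rfl
      intro j hj
      rw [Finset.mem_Icc] at hj
      push_cast at hi
      rw [(hR j).2 (by omega), mul_one]

theorem mu_pos (a : ℕ → ℤ → ℝ) (N : ℕ) (hN : 0 < N)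
    (h : ∀ k, ∀ i : ℤ, (N : ℤ) < |i| → a k i = 0) (hrc : ∀ k, ReproducesConstants (a k))
    (k n : ℕ) (μ : ℝ) (hμ0 : 0 ≤ μ)
    (hμ : opNorm (compOps (fun j => diffMask (a j)) k n) ≤ μ) : 0 < μ := by
  rcases hμ0.eq_or_lt with h0 | h0
  swap
  · exact h0
  exfalso
  obtain ⟨R, hR⟩ := step_pres a N hN h hrc k n (fun i => if 0 ≤ i then 1 else 0)
    ⟨0, fun i => ⟨fun hi => by simp at hi; simp [hi], fun hi => by simp at hi; simp [hi.le]⟩⟩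
  have hb := opNorm_bound (fun j => diffMask (a j)) (2 * N + 1) (by omega)
    (fun k => diffMask_supp _ N hN (h k) (hrc k)) k n μ hμ
    (bdiff (fun i => if 0 ≤ i then 1 else 0)) 1 (by
      intro i
      unfold bdiff
      beta_reduce
      split_ifs <;> simp)
  rw [compOps_commute a N hN h hrc, ← h0, zero_mul] at hb
  have := diff_nat _ 0 hb (2 * R + 2) (-R - 1)
  rw [(hR (-R - 1)).1 (by omega), (hR (-R - 1 + (2 * R + 2 : ℕ))).2 (by push_cast; omega)] at this
  norm_num at this

theorem key (a : ℕ → ℤ → ℝ) (N : ℕ) (hN : 0 < N)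
    (hlocal : ∀ k, ∀ i : ℤ, (N : ℤ) < |i| → a k i = 0)
    (hbdd : ∃ M : ℝ, ∀ k, ∀ i : ℤ, |a k i| ≤ M)
    (hrc : ∀ k, ReproducesConstants (a k))
    (K n : ℕ) (hn : 0 < n) (μ : ℝ) (hμ0 : 0 ≤ μ) (hμ1 : μ < 1)
    (hA : ∀ k, K ≤ k → opNorm (compOps (fun j => diffMask (a j)) k n) ≤ μ)
    (r : ℝ) (hr : r = μ ^ ((1 : ℝ) / (n : ℝ))) :
    0 < r ∧ r < 1 ∧ ∃ C : ℝ, 0 < C ∧ ∀ f0 : ℤ → ℝ, IsBoundedSeq f0 → ∀ fs : ℕ → ℤ → ℝ,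
      fs 0 = f0 → (∀ k, fs (k + 1) = subOp (a k) (fs k)) →
      ∀ x : ℝ, ∀ k : ℕ, |PL k (fs k) x - PL (k + 1) (fs (k + 1)) x| ≤
        C * seqNorm (bdiff f0) * r ^ k := by
  have hμp : 0 < μ := mu_pos a N hN hlocal hrc K n μ hμ0 (hA K le_rfl)
  have hr0 : 0 < r := by rw [hr]; exact Real.rpow_pos_of_pos hμp _
  have hr1 : r < 1 := by rw [hr]; exact Real.rpow_lt_one hμ0 hμ1 (by positivity)
  have hrn : r ^ n = μ := by
    rw [hr, one_div]; exact Real.rpow_inv_natCast_pow hμ0 (by omega)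
  obtain ⟨M, hM⟩ := hbdd
  have hM0 : 0 ≤ M := (abs_nonneg _).trans (hM 0 0)
  set E : ℝ := (2 * N + 1) * (M * N) with hE
  have hE0 : 0 ≤ E := by positivity
  set L : ℝ := 2 * E + 1 with hL
  have hL1 : 1 ≤ L := by linarith
  have hLr : 1 ≤ L / r := by rw [le_div_iff₀ hr0]; linarith
  refine ⟨hr0, hr1, (3 * E + 2) * (L / r) ^ (K + n), by positivity, ?_⟩
  intro f0 hf0 fs hfs0 hfs x k
  set D := seqNorm (bdiff f0) with hDdef
  have hD : ∀ i, |bdiff f0 i| ≤ D := by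
    apply le_seqNorm
    obtain ⟨F, hF⟩ := hf0
    exact ⟨F + F, fun i => (abs_sub _ _).trans (add_le_add (hF _) (hF _))⟩
  have hD0 : 0 ≤ D := (abs_nonneg _).trans (hD 0)
  have h1 : ∀ k i, |bdiff (fs k) i| ≤ L ^ k * D := by
    intro k
    induction k with
    | zero => rw [hfs0]; simpa using hD
    | succ k ih =>
      intro i
      rw [hfs]
      refine (bdiff_subOp_bound (a k) (fs k) N hN (hlocal k) (hrc k) M _ (hM k) ih i).trans
        (le_of_eq ?_)
      rw [← hE, ← hL]; ring
  have h2 : ∀ k i, |bdiff (fs k) i| ≤ (L / r) ^ (K + n) * r ^ k * D := by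
    intro k
    induction k using Nat.strong_induction_on with
    | _ k ih =>
      intro i
      rcases lt_or_ge k (K + n) with hk | hk
      · refine (h1 k i).trans ?_
        have e : L ^ k = (L / r) ^ k * r ^ k := by rw [← mul_pow, div_mul_cancel₀ _ hr0.ne']
        rw [e]
        have : (L / r) ^ k ≤ (L / r) ^ (K + n) := pow_le_pow_right₀ hLr hk.le
        gcongr
      · obtain ⟨p, rfl⟩ : ∃ p, k = p + n := ⟨k - n, by omega⟩
        have hb := opNorm_bound (fun j => diffMask (a j)) (2 * N + 1) (by omega)
          (fun k => diffMask_supp _ N hN (hlocal k) (hrc k)) p n μ (hA p (by omega))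
          (bdiff (fs p)) _ (ih p (by omega)) i
        rw [compOps_commute a N hN hlocal hrc, compOps_fs a fs hfs] at hb
        refine hb.trans (le_of_eq ?_)
        rw [← hrn, pow_add]; ring
  rw [hfs]
  refine (PL_step k (a k) (fs k) N hN (hlocal k) (hrc k) M _ (hM k) (h2 k) x).trans
    (le_of_eq ?_)
  rw [← hE]; ring

/-- a local, bounded non-stationary scheme reproducing constants and
satisfying Condition A (with constants `K`, `n`, `μ`) converges, with the geometric
error bound `‖S^∞ f⁰ − PL(f^[k])‖ ≤ C μ̂^k ‖Δ f⁰‖`, `μ̂ = μ^{1/n}`. -/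
theorem nonstationary_convergence_under_conditionA
    (a : ℕ → ℤ → ℝ) (N : ℕ) (hN : 0 < N)
    (hlocal : ∀ k, ∀ i : ℤ, (N : ℤ) < |i| → a k i = 0)
    (hbdd : ∃ M : ℝ, ∀ k, ∀ i : ℤ, |a k i| ≤ M)
    (hrc : ∀ k, ReproducesConstants (a k))
    (K n : ℕ) (hn : 0 < n) (μ : ℝ) (hμ0 : 0 ≤ μ) (hμ1 : μ < 1)
    (hA : ∀ k, K ≤ k → opNorm (compOps (fun j => diffMask (a j)) k n) ≤ μ) :
    (∀ f0 : ℤ → ℝ, IsBoundedSeq f0 → ∀ fs : ℕ → ℤ → ℝ, fs 0 = f0 →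
        (∀ k, fs (k + 1) = subOp (a k) (fs k)) →
        ∃ g : ℝ → ℝ, TendstoUniformly (fun k => PL k (fs k)) g atTop) ∧
      ∃ C : ℝ, 0 < C ∧ ∀ f0 : ℤ → ℝ, IsBoundedSeq f0 → ∀ fs : ℕ → ℤ → ℝ, fs 0 = f0 →
        (∀ k, fs (k + 1) = subOp (a k) (fs k)) →
        ∀ g : ℝ → ℝ, TendstoUniformly (fun k => PL k (fs k)) g atTop →
        ∀ k : ℕ, (⨆ x : ℝ, |g x - PL k (fs k) x|) ≤
          C * (μ ^ ((1 : ℝ) / (n : ℝ))) ^ k * seqNorm (bdiff f0) := by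
  obtain ⟨hr0, hr1, C, hC, hkey⟩ := key a N hN hlocal hbdd hrc K n hn μ hμ0 hμ1 hA _ rfl
  set r := μ ^ ((1 : ℝ) / (n : ℝ)) with hr
  constructor
  · intro f0 hf0 fs hfs0 hfs
    have hstep := hkey f0 hf0 fs hfs0 hfs
    have hlim : ∀ x, ∃ l, Tendsto (fun k => PL k (fs k) x) atTop (nhds l) := fun x =>
      cauchySeq_tendsto_of_complete
        (cauchySeq_of_le_geometric r _ hr1 (fun k => by rw [Real.dist_eq]; exact hstep x k))
    choose g hg using hlim
    refine ⟨g, ?_⟩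
    rw [Metric.tendstoUniformly_iff]
    intro ε hε
    have ht : Tendsto (fun k => C * seqNorm (bdiff f0) * r ^ k / (1 - r)) atTop (nhds 0) := by
      have := ((tendsto_pow_atTop_nhds_zero_of_lt_one hr0.le hr1).const_mul
        (C * seqNorm (bdiff f0))).div_const (1 - r)
      simpa using this
    filter_upwards [ht.eventually_lt_const hε] with k hk x
    rw [dist_comm]
    exact lt_of_le_of_lt (dist_le_of_le_geometric_of_tendsto r _ hr1
      (fun k => by rw [Real.dist_eq]; exact hstep x k) (hg x) k) hk
  · have h1r : 0 < 1 - r := by linarith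
    refine ⟨C / (1 - r), by positivity, ?_⟩
    intro f0 hf0 fs hfs0 hfs g hg k
    have hstep := hkey f0 hf0 fs hfs0 hfs
    apply ciSup_le
    intro x
    have := dist_le_of_le_geometric_of_tendsto r _ hr1
      (fun k => by rw [Real.dist_eq]; exact hstep x k) (hg.tendsto_at x) k
    rw [dist_comm, Real.dist_eq] at this
    refine this.trans (le_of_eq ?_)
    ring
end

section
/- Let {S_{a^{*[k]}}, k≥0} be a local, bounded non-stationary subdivision scheme which reproduces constants and satisfies Condition A. Then every local non-stationary subdivision scheme {S_{a^[k]}, k≥0} which reproduces constants and is asymptotically similar to {S_{a^{*[k]}}, k≥0} also satisfies Condition A. -/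
open Filter Set

lemma aux_diffMask_eq (a : ℤ → ℝ) (L : ℕ) (ha : ∀ i : ℤ, (L : ℤ) < |i| → a i = 0) (i : ℤ) :
    diffMask a i = ∑ j ∈ Finset.Icc (-(L : ℤ)) L,
      if j ≤ i then (-1 : ℝ) ^ (i - j) * a j else 0 := by
  unfold diffMask
  rw [finsum_eq_sum_of_support_subset (s := Finset.Icc (-(L : ℤ)) L)]
  · refine Finset.sum_congr rfl fun j _ => ?_
    rw [finsum_eq_if]
    simp
  · intro j hj
    by_contra hn
    apply hj
    have : a j = 0 := by
      apply ha
      simp only [Finset.coe_Icc, Set.mem_Icc, not_and_or, not_le] at hn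
      rw [lt_abs]; omega
    simp [this]

lemma aux_diffMask_bound (a b : ℤ → ℝ) (L : ℕ) (ha : ∀ i : ℤ, (L : ℤ) < |i| → a i = 0)
    (hb : ∀ i : ℤ, (L : ℤ) < |i| → b i = 0) (e : ℝ) (he : ∀ i, |a i - b i| ≤ e) (i : ℤ) :
    |diffMask a i - diffMask b i| ≤ (2 * L + 1) * e := by
  rw [aux_diffMask_eq a L ha, aux_diffMask_eq b L hb, ← Finset.sum_sub_distrib]
  have he0 : 0 ≤ e := (abs_nonneg _).trans (he 0)
  refine (Finset.abs_sum_le_sum_abs _ _).trans ?_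
  refine (Finset.sum_le_card_nsmul _ _ e ?_).trans ?_
  · intro j _
    split_ifs with h
    · rw [← mul_sub, abs_mul, abs_zpow]
      simpa using he j
    · simpa using he0
  · rw [nsmul_eq_mul]
    apply mul_le_mul_of_nonneg_right _ he0
    rw [Int.card_Icc]
    have : ((L : ℤ) + 1 - -(L : ℤ)).toNat = 2 * L + 1 := by omega
    rw [this]; push_cast; exact le_rfl

lemma aux_diffMask_support (a : ℤ → ℝ) (L : ℕ) (ha : ∀ i : ℤ, (L : ℤ) < |i| → a i = 0)
    (hr : ReproducesConstants a) (i : ℤ) (hi : (L : ℤ) < |i|) : diffMask a i = 0 := by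
  rw [aux_diffMask_eq a L ha]
  rw [lt_abs] at hi
  rcases hi with hi | hi
  · have hsupp : ∀ j ∉ Finset.Icc (-(L : ℤ)) L, a j = 0 := by
      intro j hj
      apply ha
      simp only [Finset.mem_Icc, not_and_or, not_le] at hj
      rw [lt_abs]; omega
    have h1 : ∑ j ∈ Finset.Icc (-(L : ℤ)) L, (if j ≤ i then (-1 : ℝ) ^ (i - j) * a j else 0)
        = (-1 : ℝ) ^ i * ∑ j ∈ Finset.Icc (-(L : ℤ)) L, (-1 : ℝ) ^ j * a j := by
      rw [Finset.mul_sum]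
      refine Finset.sum_congr rfl fun j hj => ?_
      rw [Finset.mem_Icc] at hj
      rw [if_pos (by omega), zpow_sub₀ (by norm_num), ← mul_assoc, div_eq_mul_inv, ← inv_zpow]
      norm_num
    rw [h1]
    have h2 : HasSum (fun j : ℤ => (-1 : ℝ) ^ j * a j)
        (∑ j ∈ Finset.Icc (-(L : ℤ)) L, (-1 : ℝ) ^ j * a j) := by
      apply hasSum_sum_of_ne_finset_zero
      intro j hj
      simp [hsupp j hj]
    have hfin : (Function.support a).Finite := by
      refine (Finset.Icc (-(L : ℤ)) L).finite_toSet.subset ?_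
      intro j hj
      by_contra h
      exact hj (hsupp j (by simpa using h))
    have fe : (Function.support fun j : ℤ => a (2 * j)).Finite :=
      hfin.preimage (f := fun j : ℤ => 2 * j) (fun x _ y _ h => by simpa using h)
    have fo : (Function.support fun j : ℤ => a (2 * j + 1)).Finite :=
      hfin.preimage (f := fun j : ℤ => 2 * j + 1) (fun x _ y _ h => by simpa using h)
    have h3 : HasSum (fun j : ℤ => a (2 * j)) 1 := by
      have h := (summable_of_hasFiniteSupport (L := SummationFilter.unconditional ℤ) fe).hasSum
      rwa [tsum_eq_finsum fe, hr.1] at h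
    have h4 : HasSum (fun j : ℤ => a (2 * j + 1)) 1 := by
      have h := (summable_of_hasFiniteSupport (L := SummationFilter.unconditional ℤ) fo).hasSum
      rwa [tsum_eq_finsum fo, hr.2] at h
    have h3' : HasSum (fun j : ℤ => if Even j then a j else 0) 1 := by
      have inj : Function.Injective (fun j : ℤ => 2 * j) := fun x y h => by simpa using h
      rw [← inj.hasSum_iff]
      · simpa [Function.comp_def] using h3
      · intro x hx
        rw [if_neg]
        rintro ⟨r, hr⟩
        exact hx ⟨r, by simp only; omega⟩
    have h4' : HasSum (fun j : ℤ => if Even j then 0 else - a j) (-1) := by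
      have inj : Function.Injective (fun j : ℤ => 2 * j + 1) := fun x y h => by simpa using h
      rw [← inj.hasSum_iff]
      · have hne : ∀ x : ℤ, ¬ Even (2 * x + 1) := fun x => by
          rw [Int.not_even_iff_odd]; exact ⟨x, rfl⟩
        simp only [Function.comp_def, hne, if_false]
        exact h4.neg
      · intro x hx
        rw [if_pos]
        by_contra hne
        rw [Int.not_even_iff_odd] at hne
        obtain ⟨r, hr⟩ := hne
        exact hx ⟨r, by simp only; omega⟩
    have h5 : HasSum (fun j : ℤ => (-1 : ℝ) ^ j * a j) (1 + -1) := by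
      have h6 := h3'.add h4'
      have h7 : (fun j : ℤ => (-1 : ℝ) ^ j * a j) =
          fun j : ℤ => (if Even j then a j else 0) + (if Even j then 0 else - a j) := by
        funext j
        by_cases hj : Even j
        · simp [hj, hj.neg_one_zpow]
        · simp [hj, (Int.not_even_iff_odd.1 hj).neg_one_zpow]
      rw [h7]; exact h6
    rw [h2.unique h5]; simp
  · apply Finset.sum_eq_zero
    intro j hj
    rw [Finset.mem_Icc] at hj
    rw [if_neg (by omega)]

lemma aux_subOp_eq (q : ℤ → ℝ) (L : ℕ) (hq : ∀ i : ℤ, (L : ℤ) < |i| → q i = 0)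
    (f : ℤ → ℝ) (i : ℤ) :
    subOp q f i = ∑ j ∈ Finset.Icc ((i - L) / 2) ((i + L) / 2), q (i - 2 * j) * f j := by
  unfold subOp
  apply finsum_eq_sum_of_support_subset
  intro j hj
  by_contra hn
  apply hj
  have : q (i - 2 * j) = 0 := by
    apply hq
    simp only [Finset.coe_Icc, Set.mem_Icc, not_and_or, not_le] at hn
    rw [lt_abs]; omega
  simp [this]

lemma aux_sum_bound (g f : ℤ → ℝ) (L : ℕ) (B F : ℝ) (hg : ∀ i, |g i| ≤ B) (hf : ∀ i, |f i| ≤ F)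
    (i : ℤ) : |∑ j ∈ Finset.Icc ((i - L) / 2) ((i + L) / 2), g (i - 2 * j) * f j|
      ≤ (2 * L + 2) * (B * F) := by
  have hB : 0 ≤ B := (abs_nonneg _).trans (hg 0)
  have hF : 0 ≤ F := (abs_nonneg _).trans (hf 0)
  refine (Finset.abs_sum_le_sum_abs _ _).trans ?_
  refine (Finset.sum_le_card_nsmul _ _ (B * F) ?_).trans ?_
  · intro j _
    rw [abs_mul]
    exact mul_le_mul (hg _) (hf _) (abs_nonneg _) hB
  · rw [nsmul_eq_mul]
    apply mul_le_mul_of_nonneg_right _ (mul_nonneg hB hF)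
    rw [Int.card_Icc]
    have : ((i + (L : ℤ)) / 2 + 1 - (i - (L : ℤ)) / 2).toNat ≤ 2 * L + 2 := by omega
    exact_mod_cast this

lemma aux_compOps_bound (q : ℕ → ℤ → ℝ) (L : ℕ) (hq : ∀ k, ∀ i : ℤ, (L : ℤ) < |i| → q k i = 0)
    (B : ℝ) (hB : ∀ k i, |q k i| ≤ B) (k n : ℕ) (f : ℤ → ℝ) (hf : ∀ i, |f i| ≤ 1) (i : ℤ) :
    |compOps q k n f i| ≤ ((2 * L + 2) * B) ^ n := by
  induction n generalizing i with
  | zero => simpa [compOps] using hf i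
  | succ n ih =>
    simp only [compOps, Function.comp]
    rw [aux_subOp_eq _ L (hq _)]
    refine (aux_sum_bound _ _ L B _ (hB _) ih i).trans (le_of_eq ?_)
    ring

lemma aux_compOps_diff (q p : ℕ → ℤ → ℝ) (L : ℕ)
    (hq : ∀ k, ∀ i : ℤ, (L : ℤ) < |i| → q k i = 0)
    (hp : ∀ k, ∀ i : ℤ, (L : ℤ) < |i| → p k i = 0)
    (B : ℝ) (hB : ∀ k i, |p k i| ≤ B)
    (hqp : ∀ e : ℝ, 0 < e → ∃ K, ∀ k, K ≤ k → ∀ i, |q k i - p k i| ≤ e) (n : ℕ) :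
    ∀ e : ℝ, 0 < e → ∃ K, ∀ k, K ≤ k → ∀ f : ℤ → ℝ, (∀ i, |f i| ≤ 1) →
      ∀ i, |compOps q k n f i - compOps p k n f i| ≤ e := by
  have hB0 : 0 ≤ B := (abs_nonneg _).trans (hB 0 0)
  induction n with
  | zero =>
    intro e he
    exact ⟨0, fun k _ f _ i => by simpa [compOps] using he.le⟩
  | succ n ih =>
    intro e he
    set c : ℝ := 2 * L + 2 with hc
    have hc0 : 0 < c := by positivity
    set D : ℝ := (c * B) ^ n with hD
    have hD0 : 0 ≤ D := by positivity
    obtain ⟨K1, h1⟩ := ih (e / (2 * c * (B + 1))) (by positivity)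
    obtain ⟨K2, h2⟩ := hqp (min 1 (e / (2 * c * (D + 1)))) (by positivity)
    refine ⟨max K1 K2, fun k hk f hf i => ?_⟩
    have hk1 : K1 ≤ k := (le_max_left _ _).trans hk
    have hk2 : K2 ≤ k + n := ((le_max_right _ _).trans hk).trans (Nat.le_add_right _ _)
    have hqB : ∀ i, |q (k + n) i| ≤ B + 1 := by
      intro i
      have e1 := (h2 _ hk2 i).trans (min_le_left _ _)
      have e2 := hB (k + n) i
      have e3 := abs_add_le (q (k + n) i - p (k + n) i) (p (k + n) i)
      rw [sub_add_cancel] at e3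
      linarith
    have A1 := aux_sum_bound (q (k + n)) (fun j => compOps q k n f j - compOps p k n f j) L
      (B + 1) _ hqB (h1 k hk1 f hf) i
    have A2 := aux_sum_bound (fun j => q (k + n) j - p (k + n) j) (compOps p k n f) L
      _ D (fun i => (h2 _ hk2 i).trans (min_le_right _ _))
      (aux_compOps_bound p L hp B hB k n f hf) i
    simp only [compOps, Function.comp]
    rw [aux_subOp_eq _ L (hq _), aux_subOp_eq _ L (hp _)]
    have hs : (∑ j ∈ Finset.Icc ((i - L) / 2) ((i + L) / 2), q (k + n) (i - 2 * j) * compOps q k n f j)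
        - (∑ j ∈ Finset.Icc ((i - L) / 2) ((i + L) / 2), p (k + n) (i - 2 * j) * compOps p k n f j)
        = (∑ j ∈ Finset.Icc ((i - L) / 2) ((i + L) / 2), q (k + n) (i - 2 * j) *
            (compOps q k n f j - compOps p k n f j))
        + ∑ j ∈ Finset.Icc ((i - L) / 2) ((i + L) / 2),
            (q (k + n) (i - 2 * j) - p (k + n) (i - 2 * j)) * compOps p k n f j := by
      rw [← Finset.sum_sub_distrib, ← Finset.sum_add_distrib]
      exact Finset.sum_congr rfl fun j _ => by ring
    rw [hs]
    refine (abs_add_le _ _).trans ?_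
    have B1 : c * ((B + 1) * (e / (2 * c * (B + 1)))) = e / 2 := by
      field_simp
    have B2 : c * (e / (2 * c * (D + 1)) * D) ≤ e / 2 := by
      have : c * (e / (2 * c * (D + 1)) * D) = e / 2 * (D / (D + 1)) := by
        field_simp
      rw [this]
      have h : D / (D + 1) ≤ 1 := by
        rw [div_le_one (by positivity)]; linarith
      nlinarith
    linarith

/-- Condition A transfers to any scheme reproducing constants that is
asymptotically similar to a bounded scheme reproducing constants satisfying Condition A. -/
theorem conditionA_of_asympSimilar
    (astar : ℕ → ℤ → ℝ) (N' : ℕ) (hN' : 0 < N')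
    (hlocal' : ∀ k, ∀ i : ℤ, (N' : ℤ) < |i| → astar k i = 0)
    (hbdd' : ∃ M : ℝ, ∀ k, ∀ i : ℤ, |astar k i| ≤ M)
    (hrc' : ∀ k, ReproducesConstants (astar k))
    (hA' : ConditionA astar)
    (a : ℕ → ℤ → ℝ) (N : ℕ) (hN : 0 < N)
    (hlocal : ∀ k, ∀ i : ℤ, (N : ℤ) < |i| → a k i = 0)
    (hrc : ∀ k, ReproducesConstants (a k))
    (hsim : AsympSimilar a astar) :
    ConditionA a := by
  obtain ⟨M, hM⟩ := hbdd'
  obtain ⟨K, n, hn, μ, hμ, hK⟩ := hA'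
  set L : ℕ := max N N' with hL
  have hl : ∀ k, ∀ i : ℤ, (L : ℤ) < |i| → a k i = 0 := fun k i hi =>
    hlocal k i (by have : N ≤ L := le_max_left _ _; omega)
  have hl' : ∀ k, ∀ i : ℤ, (L : ℤ) < |i| → astar k i = 0 := fun k i hi =>
    hlocal' k i (by have : N' ≤ L := le_max_right _ _; omega)
  have hq := fun k => aux_diffMask_support (a k) L (hl k) (hrc k)
  have hp := fun k => aux_diffMask_support (astar k) L (hl' k) (hrc' k)
  have hB : ∀ k i, |diffMask (astar k) i| ≤ (2 * L + 1) * M := by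
    intro k i
    have := aux_diffMask_bound (astar k) (fun _ => 0) L (hl' k) (fun _ _ => rfl) M
      (by simpa using hM k) i
    simpa [diffMask] using this
  have hqp : ∀ e : ℝ, 0 < e → ∃ K, ∀ k, K ≤ k → ∀ i,
      |diffMask (a k) i - diffMask (astar k) i| ≤ e := by
    intro e he
    have h1 : ∀ᶠ k in atTop, seqNorm (fun i => a k i - astar k i) < e / (2 * L + 1) :=
      hsim.eventually_lt_const (by positivity)
    obtain ⟨K, h1⟩ := eventually_atTop.1 h1
    refine ⟨K, fun k hk i => ?_⟩
    have hbd : BddAbove (range fun i => |a k i - astar k i|) := by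
      have : (range fun i => |a k i - astar k i|).Finite := by
        apply Set.Finite.subset (((Finset.Icc (-(L : ℤ)) L).finite_toSet.image
          (fun i => |a k i - astar k i|)).insert 0)
        rintro _ ⟨j, rfl⟩
        by_cases hj : (L : ℤ) < |j|
        · left; simp [hl k j hj, hl' k j hj]
        · right
          exact ⟨j, by simpa [abs_le] using hj, rfl⟩
      exact this.bddAbove
    have := aux_diffMask_bound (a k) (astar k) L (hl k) (hl' k) (e / (2 * L + 1))
      (fun i => (le_ciSup hbd i).trans (h1 k hk).le) i
    rwa [mul_div_cancel₀ _ (by positivity)] at this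
  obtain ⟨K', hK'⟩ := aux_compOps_diff (fun k => diffMask (a k)) (fun k => diffMask (astar k)) L
    hq hp _ hB hqp n ((1 - μ) / 2) (by linarith)
  refine ⟨max K K', n, hn, μ + (1 - μ) / 2, by linarith, fun k hk => ?_⟩
  have hk1 := hK k ((le_max_left _ _).trans hk)
  have hk2 := hK' k ((le_max_right _ _).trans hk)
  have hcb := aux_compOps_bound _ L hp _ hB k n
  apply csSup_le
  · exact ⟨_, fun _ => 0, ⟨0, by simp⟩, by simp [seqNorm], rfl⟩
  · rintro c ⟨f, ⟨F, hF⟩, hf1, rfl⟩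
    have hf : ∀ i, |f i| ≤ 1 := fun i =>
      (le_ciSup (f := fun i => |f i|) ⟨F, by rintro _ ⟨j, rfl⟩; exact hF j⟩ i).trans hf1
    apply ciSup_le
    intro i
    have e1 : |compOps (fun j => diffMask (astar j)) k n f i| ≤ μ := by
      refine (le_ciSup (f := fun i => |compOps (fun j => diffMask (astar j)) k n f i|)
        ⟨_, by rintro _ ⟨j, rfl⟩; exact hcb f hf j⟩ i).trans (le_trans ?_ hk1)
      apply le_csSup
      · refine ⟨((2 * L + 2) * ((2 * L + 1) * M)) ^ n, ?_⟩
        rintro c ⟨g, ⟨G, hG⟩, hg1, rfl⟩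
        apply ciSup_le
        intro j
        exact hcb g (fun i =>
          (le_ciSup (f := fun i => |g i|) ⟨G, by rintro _ ⟨j, rfl⟩; exact hG j⟩ i).trans hg1) j
      · exact ⟨f, ⟨F, hF⟩, hf1, rfl⟩
    have e2 := hk2 f hf i
    have e3 := abs_add_le (compOps (fun j => diffMask (a j)) k n f i -
      compOps (fun j => diffMask (astar j)) k n f i)
      (compOps (fun j => diffMask (astar j)) k n f i)
    rw [sub_add_cancel] at e3
    linarith
end
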